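/- arXiv:1005.2598 — 4 statements merged into one kernel-verified Lean document; each statement's English description precedes it below -/
import Mathlib

section
/- Let X be a random variable uniformly distributed on an interval (a,b) with 0 ≤ a < b. Then the Kolmogorov–Smirnov distance between the distribution of the fractional part of log₁₀ X and the uniform distribution on [0,1) is at least (−9 + ln 10 + 9·ln 9 − 9·ln(ln 10)) / (18·ln 10). -/
open MeasureTheory Set

/-- The Kolmogorov–Smirnov distance between two (Borel) measures on `ℝ`:
the supremum over `x ∈ ℝ` of the absolute difference of their cumulative
distribution functions. -/
noncomputable def ksDist (μ ν : Measure ℝ) : ℝ :=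
  ⨆ x : ℝ, |(μ (Iic x)).toReal - (ν (Iic x)).toReal|

/-- The points `x` whose base-10 logarithm precedes that of `b`, modulo `1`, by less than `y`. -/
def logArc (b y : ℝ) : Set ℝ :=
  {x | Int.fract (Real.logb 10 b - Real.logb 10 x) < y}

lemma measurable_logb_ten : Measurable (Real.logb 10) := by
  unfold Real.logb
  exact Real.measurable_log.div_const _

lemma measurableSet_logArc (b y : ℝ) : MeasurableSet (logArc b y) :=
  measurableSet_lt (measurable_fract.comp (measurable_const.sub measurable_logb_ten))
    measurable_const

lemma zpow_mul_mem_logArc_iff {b y x : ℝ} (hx : 0 < x) (k : ℤ) :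
    (10 : ℝ) ^ k * x ∈ logArc b y ↔ x ∈ logArc b y := by
  have h : Real.logb 10 ((10 : ℝ) ^ k * x) = k + Real.logb 10 x := by
    rw [Real.logb_mul (by positivity) hx.ne', ← Real.rpow_intCast,
      Real.logb_rpow (by norm_num) (by norm_num)]
  simp only [logArc, mem_ofPred_eq, h]
  rw [show Real.logb 10 b - (k + Real.logb 10 x) = Real.logb 10 b - Real.logb 10 x - k by ring,
    Int.fract_sub_intCast]

lemma mem_logArc_iff_of_mem_Ioc {b y x : ℝ} (hb : 0 < b) (hx : x ∈ Ioc (b / 10) b) :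
    x ∈ logArc b y ↔ b * (10 : ℝ) ^ (-y) < x := by
  have hx0 : 0 < x := lt_trans (by positivity) hx.1
  have h1 : Real.logb 10 x ≤ Real.logb 10 b :=
    Real.logb_le_logb_of_le (by norm_num) hx0 hx.2
  have h2 : Real.logb 10 b - 1 < Real.logb 10 x := by
    have := Real.logb_lt_logb (b := 10) (by norm_num) (by positivity) hx.1
    rwa [Real.logb_div hb.ne' (by norm_num), Real.logb_self_eq_one (by norm_num)] at this
  have h3 : b * (10 : ℝ) ^ (-y) < x ↔ Real.logb 10 b + -y < Real.logb 10 x := by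
    rw [← Real.logb_lt_logb_iff (b := 10) (by norm_num) (by positivity) hx0,
      Real.logb_mul hb.ne' (by positivity), Real.logb_rpow (by norm_num) (by norm_num)]
  rw [h3, logArc, mem_ofPred_eq, Int.fract_eq_self.2 ⟨by linarith, by linarith⟩]
  constructor <;> intro h <;> linarith

lemma volume_real_logArc_zpow_mul (b y x : ℝ) (k : ℤ) :
    volume.real (logArc b y ∩ Ioc 0 ((10 : ℝ) ^ k * x)) =
      (10 : ℝ) ^ k * volume.real (logArc b y ∩ Ioc 0 x) := by
  have hc : (0 : ℝ) < (10 : ℝ) ^ k := by positivity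
  have h : (fun z => (10 : ℝ) ^ k * z) ⁻¹' (logArc b y ∩ Ioc 0 ((10 : ℝ) ^ k * x)) =
      logArc b y ∩ Ioc 0 x := by
    ext z
    simp only [mem_preimage, mem_inter_iff, mem_Ioc, mul_pos_iff_of_pos_left hc,
      mul_le_mul_iff_right₀ hc]
    constructor
    · rintro ⟨h1, h2, h3⟩
      exact ⟨(zpow_mul_mem_logArc_iff h2 k).1 h1, h2, h3⟩
    · rintro ⟨h1, h2, h3⟩
      exact ⟨(zpow_mul_mem_logArc_iff h2 k).2 h1, h2, h3⟩
  rw [← h, measureReal_def, measureReal_def, Real.volume_preimage_mul_left hc.ne',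
    ENNReal.toReal_mul, abs_of_pos (inv_pos.2 hc), ENNReal.toReal_ofReal (inv_pos.2 hc).le,
    mul_inv_cancel_left₀ hc.ne']

lemma volume_real_inter_Ioc_add {s : Set ℝ} (hs : MeasurableSet s) {p q r : ℝ} (hpq : p ≤ q)
    (hqr : q ≤ r) :
    volume.real (s ∩ Ioc p r) = volume.real (s ∩ Ioc p q) + volume.real (s ∩ Ioc q r) := by
  rw [← Ioc_union_Ioc_eq_Ioc hpq hqr, inter_union_distrib_left]
  refine measureReal_union ?_ (hs.inter measurableSet_Ioc)
    (measure_ne_top_of_subset inter_subset_right (by simp))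
    (measure_ne_top_of_subset inter_subset_right (by simp))
  exact (Ioc_disjoint_Ioc_of_le le_rfl).mono inter_subset_right inter_subset_right

lemma logArc_inter_Ioc_eq_empty {b y x : ℝ} (hb : 0 < b) (hy : 0 ≤ y)
    (hx : x ≤ b * (10 : ℝ) ^ (-y)) : logArc b y ∩ Ioc (b / 10) x = ∅ := by
  have h1 : (10 : ℝ) ^ (-y) ≤ 1 := Real.rpow_le_one_of_one_le_of_nonpos (by norm_num) (by linarith)
  have hxb : x ≤ b := hx.trans (mul_le_of_le_one_right hb.le h1)
  refine eq_empty_of_forall_notMem fun z hz => ?_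
  have := (mem_logArc_iff_of_mem_Ioc hb ⟨hz.2.1, hz.2.2.trans hxb⟩).1 hz.1
  linarith [hz.2.2]

lemma logArc_inter_Ioc_eq {b y x : ℝ} (hb : 0 < b) (hy : y ≤ 1)
    (hx : b * (10 : ℝ) ^ (-y) ≤ x) : logArc b y ∩ Ioc x b = Ioc x b := by
  have h1 : (10 : ℝ) ^ (-1 : ℝ) ≤ (10 : ℝ) ^ (-y) :=
    Real.rpow_le_rpow_of_exponent_le (by norm_num) (by linarith)
  rw [Real.rpow_neg_one] at h1
  have hxb : b / 10 ≤ x := by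
    rw [div_eq_mul_inv]
    exact (mul_le_mul_of_nonneg_left h1 hb.le).trans hx
  refine inter_eq_right.2 fun z hz => ?_
  exact (mem_logArc_iff_of_mem_Ioc hb ⟨hxb.trans_lt hz.1, hz.2⟩).2 (hx.trans_lt hz.1)

lemma volume_real_logArc {b y : ℝ} (hb : 0 < b) (hy0 : 0 ≤ y) (hy1 : y ≤ 1) :
    volume.real (logArc b y ∩ Ioc 0 b) = (1 - (10 : ℝ) ^ (-y)) / (9 / 10) * b := by
  have h1 : (10 : ℝ) ^ (-1 : ℝ) ≤ (10 : ℝ) ^ (-y) :=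
    Real.rpow_le_rpow_of_exponent_le (by norm_num) (by linarith)
  have h2 : (10 : ℝ) ^ (-y) ≤ 1 := Real.rpow_le_one_of_one_le_of_nonpos (by norm_num) (by linarith)
  rw [Real.rpow_neg_one] at h1
  have hm := measurableSet_logArc b y
  have hs := volume_real_logArc_zpow_mul b y b (-1)
  rw [zpow_neg_one, inv_mul_eq_div, inv_mul_eq_div] at hs
  have e1 : b / 10 ≤ b * (10 : ℝ) ^ (-y) := by
    rw [div_eq_mul_inv]
    gcongr
  have e2 : b * (10 : ℝ) ^ (-y) ≤ b := mul_le_of_le_one_right hb.le h2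
  have hadd := volume_real_inter_Ioc_add hm (by positivity : (0 : ℝ) ≤ b / 10) (e1.trans e2)
  have hadd' := volume_real_inter_Ioc_add hm e1 e2
  rw [logArc_inter_Ioc_eq_empty hb hy0 le_rfl, logArc_inter_Ioc_eq hb hy1 le_rfl,
    Real.volume_real_Ioc_of_le e2, measureReal_empty] at hadd'
  linarith

lemma volume_real_logArc_le {a b y : ℝ} (ha : 0 ≤ a) (hb : 0 < b) (hy0 : 0 ≤ y) (hy1 : y ≤ 1) :
    volume.real (logArc b y ∩ Ioc 0 a) ≤ (1 - (10 : ℝ) ^ (-y)) / (9 / 10) * a := by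
  rcases ha.eq_or_lt with rfl | ha
  · simp
  obtain ⟨n, hn1, hn2⟩ := exists_mem_Ioc_zpow (div_pos ha hb) (by norm_num : (1 : ℝ) < 10)
  have hc : (0 : ℝ) < (10 : ℝ) ^ (n + 1) := by positivity
  obtain ⟨x, rfl⟩ : ∃ x, a = (10 : ℝ) ^ (n + 1) * x := ⟨a / 10 ^ (n + 1), by field_simp⟩
  have hxb : x ≤ b := by
    rw [div_le_iff₀ hb] at hn2
    exact le_of_mul_le_mul_left hn2 hc
  have hbx : b / 10 < x := by
    rw [lt_div_iff₀ hb] at hn1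
    refine lt_of_mul_lt_mul_left ?_ hc.le
    calc (10 : ℝ) ^ (n + 1) * (b / 10) = 10 ^ n * b := by
          rw [zpow_add_one₀ (by norm_num)]; ring
      _ < _ := hn1
  rw [volume_real_logArc_zpow_mul, mul_left_comm]
  refine mul_le_mul_of_nonneg_left ?_ hc.le
  have h1 : (10 : ℝ) ^ (-1 : ℝ) ≤ (10 : ℝ) ^ (-y) :=
    Real.rpow_le_rpow_of_exponent_le (by norm_num) (by linarith)
  have h2 : (10 : ℝ) ^ (-y) ≤ 1 := Real.rpow_le_one_of_one_le_of_nonpos (by norm_num) (by linarith)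
  rw [Real.rpow_neg_one] at h1
  have hm := measurableSet_logArc b y
  have hvol := volume_real_logArc hb hy0 hy1
  rcases le_total x (b * (10 : ℝ) ^ (-y)) with hx | hx
  · have hs := volume_real_logArc_zpow_mul b y b (-1)
    rw [zpow_neg_one, inv_mul_eq_div, inv_mul_eq_div] at hs
    have hadd := volume_real_inter_Ioc_add hm (by positivity : (0 : ℝ) ≤ b / 10) hbx.le
    rw [logArc_inter_Ioc_eq_empty hb hy0 hx, measureReal_empty, hs, hvol] at hadd
    nlinarith
  · have hx0 : 0 ≤ x := le_trans (by positivity) hbx.le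
    have hadd := volume_real_inter_Ioc_add hm hx0 hxb
    rw [logArc_inter_Ioc_eq hb hy1 hx, Real.volume_real_Ioc_of_le hxb, hvol] at hadd
    nlinarith

lemma le_volume_real_logArc {a b y : ℝ} (ha : 0 ≤ a) (hab : a < b) (hy0 : 0 ≤ y) (hy1 : y ≤ 1) :
    (1 - (10 : ℝ) ^ (-y)) / (9 / 10) * (b - a) ≤ volume.real (logArc b y ∩ Ioo a b) := by
  have hb : 0 < b := ha.trans_lt hab
  have hadd := volume_real_inter_Ioc_add (measurableSet_logArc b y) ha hab.le
  have h : volume.real (logArc b y ∩ Ioo a b) = volume.real (logArc b y ∩ Ioc a b) :=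
    measureReal_congr (ae_eq_set_inter (ae_eq_refl _) Ioo_ae_eq_Ioc)
  rw [h]
  linarith [volume_real_logArc hb hy0 hy1, volume_real_logArc_le ha hb hy0 hy1]

lemma volume_restrict_Ico_Iic {x : ℝ} (h0 : 0 ≤ x) (h1 : x < 1) :
    ((volume.restrict (Ico (0 : ℝ) 1)) (Iic x)).toReal = x := by
  rw [Measure.restrict_apply measurableSet_Iic,
    show Iic x ∩ Ico (0 : ℝ) 1 = Icc 0 x by
      ext z
      simp only [mem_inter_iff, mem_Iic, mem_Ico, mem_Icc]
      exact ⟨fun h => ⟨h.2.1, h.1⟩, fun h => ⟨h.2, h.1, h.2.trans_lt h1⟩⟩,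
    Real.volume_Icc, sub_zero, ENNReal.toReal_ofReal h0]

lemma abs_cdf_sub_le_ksDist (μ ν : Measure ℝ) [IsProbabilityMeasure μ] [IsProbabilityMeasure ν]
    (x : ℝ) : |(μ (Iic x)).toReal - (ν (Iic x)).toReal| ≤ ksDist μ ν := by
  refine le_ciSup (f := fun x : ℝ => |(μ (Iic x)).toReal - (ν (Iic x)).toReal|) ⟨1, ?_⟩ x
  rintro _ ⟨z, rfl⟩
  have h1 : (μ (Iic z)).toReal ≤ 1 := measureReal_le_one
  have h2 : (ν (Iic z)).toReal ≤ 1 := measureReal_le_one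
  exact abs_sub_le_iff.2
    ⟨by linarith [ENNReal.toReal_nonneg (a := ν (Iic z))],
      by linarith [ENNReal.toReal_nonneg (a := μ (Iic z))]⟩

/-- A distribution on `[0, 1)` gives an arc of length `y` modulo `1` a mass exceeding `y` by at
most twice its Kolmogorov–Smirnov distance to the uniform distribution. -/
lemma measureReal_arc_le (μ : Measure ℝ) [IsProbabilityMeasure μ] (hμ : ∀ᵐ x ∂μ, x ∈ Ico (0 : ℝ) 1)
    (c y : ℝ) (hy0 : 0 ≤ y) (hy1 : y ≤ 1) :
    μ.real {x | Int.fract (c - x) < y} ≤ y + 2 * ksDist μ (volume.restrict (Ico 0 1)) := by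
  have : IsProbabilityMeasure (volume.restrict (Ico (0 : ℝ) 1)) := ⟨by simp⟩
  set D := ksDist μ (volume.restrict (Ico 0 1))
  have hD : ∀ x : ℝ, 0 ≤ x → x < 1 → |μ.real (Iic x) - x| ≤ D := fun x h0 h1 => by
    have := abs_cdf_sub_le_ksDist μ (volume.restrict (Ico 0 1)) x
    rwa [volume_restrict_Ico_Iic h0 h1] at this
  set β := Int.fract c with hβ
  have hβ0 : 0 ≤ β := Int.fract_nonneg c
  have hβ1 : β < 1 := Int.fract_lt_one c
  have hfr : ∀ x, Int.fract (c - x) = Int.fract (β - x) := fun x => by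
    rw [show β - x = c - x - (⌊c⌋ : ℤ) by rw [hβ, Int.fract]; ring, Int.fract_sub_intCast]
  have hle : ∀ x, 0 ≤ x → x ≤ β → Int.fract (β - x) = β - x := fun x h1 h2 =>
    Int.fract_eq_self.2 ⟨by linarith, by linarith⟩
  have hgt : ∀ x, x < 1 → β < x → Int.fract (β - x) = β - x + 1 := fun x h1 h2 => by
    rw [← Int.fract_add_one, Int.fract_eq_self.2 ⟨by linarith, by linarith⟩]
  have hDβ := abs_le.1 (hD β hβ0 hβ1)
  rcases le_or_gt y β with h | h
  · have hsub : μ.real {x | Int.fract (c - x) < y} ≤ μ.real (Iic β \ Iic (β - y)) := by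
      refine ENNReal.toReal_mono (measure_ne_top _ _) (measure_mono_ae ?_)
      filter_upwards [hμ] with x hx hxy
      change Int.fract (c - x) < y at hxy
      rw [hfr] at hxy
      change x ≤ β ∧ ¬ x ≤ β - y
      rcases le_or_gt x β with h' | h'
      · rw [hle x hx.1 h'] at hxy
        exact ⟨h', by linarith⟩
      · rw [hgt x hx.2 h'] at hxy
        linarith [hx.2]
    rw [measureReal_sdiff (Iic_subset_Iic.2 (by linarith)) measurableSet_Iic] at hsub
    have := abs_le.1 (hD (β - y) (by linarith) (by linarith))
    linarith
  · have hsub : μ.real {x | Int.fract (c - x) < y} ≤ μ.real (Iic β ∪ (Iic (β + 1 - y))ᶜ) := by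
      refine ENNReal.toReal_mono (measure_ne_top _ _) (measure_mono_ae ?_)
      filter_upwards [hμ] with x hx hxy
      change Int.fract (c - x) < y at hxy
      rw [hfr] at hxy
      change x ≤ β ∨ ¬ x ≤ β + 1 - y
      rcases le_or_gt x β with h' | h'
      · exact Or.inl h'
      · rw [hgt x hx.2 h'] at hxy
        exact Or.inr (by linarith)
    have hun := measureReal_union_le (μ := μ) (Iic β) (Iic (β + 1 - y))ᶜ
    rw [probReal_compl_eq_one_sub measurableSet_Iic] at hun
    have := abs_le.1 (hD (β + 1 - y) (by linarith) (by linarith))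
    linarith

lemma le_two_mul_ksDist_of_uniform
    {Ω : Type*} [MeasurableSpace Ω] (ℙ : Measure Ω) [IsProbabilityMeasure ℙ]
    (X : Ω → ℝ) (hXm : Measurable X) (a b : ℝ) (ha : 0 ≤ a) (hab : a < b)
    (hX : Measure.map X ℙ = (ENNReal.ofReal (b - a))⁻¹ • volume.restrict (Ioo a b))
    (y : ℝ) (hy0 : 0 ≤ y) (hy1 : y ≤ 1) :
    (1 - (10 : ℝ) ^ (-y)) / (9 / 10) - y ≤
      2 * ksDist (Measure.map (fun ω => Int.fract (Real.logb 10 (X ω))) ℙ)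
        (volume.restrict (Ico 0 1)) := by
  have hfm : Measurable fun ω => Int.fract (Real.logb 10 (X ω)) :=
    measurable_fract.comp (measurable_logb_ten.comp hXm)
  have hμ := Measure.isProbabilityMeasure_map (μ := ℙ) hfm.aemeasurable
  have harc := measureReal_arc_le (Measure.map (fun ω => Int.fract (Real.logb 10 (X ω))) ℙ)
    ((ae_map_iff hfm.aemeasurable measurableSet_Ico).2
      (.of_forall fun ω => ⟨Int.fract_nonneg _, Int.fract_lt_one _⟩)) (Real.logb 10 b) y hy0 hy1
  have hba : 0 < b - a := sub_pos.2 hab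
  have hmeas : (Measure.map (fun ω => Int.fract (Real.logb 10 (X ω))) ℙ).real
      {x | Int.fract (Real.logb 10 b - x) < y} =
      (b - a)⁻¹ * volume.real (logArc b y ∩ Ioo a b) := by
    have hset : (fun ω => Int.fract (Real.logb 10 (X ω))) ⁻¹'
        {x | Int.fract (Real.logb 10 b - x) < y} = X ⁻¹' logArc b y := by
      ext ω
      simp only [logArc, mem_preimage, mem_ofPred_eq]
      rw [show Real.logb 10 b - Int.fract (Real.logb 10 (X ω)) =
        Real.logb 10 b - Real.logb 10 (X ω) + ⌊Real.logb 10 (X ω)⌋ by rw [Int.fract]; ring,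
        Int.fract_add_intCast]
    have harcm : MeasurableSet {x | Int.fract (Real.logb 10 b - x) < y} :=
      measurableSet_lt (measurable_fract.comp (measurable_const.sub measurable_id))
        measurable_const
    rw [measureReal_def, Measure.map_apply hfm harcm, hset,
      ← Measure.map_apply hXm (measurableSet_logArc b y), hX, Measure.smul_apply,
      Measure.restrict_apply (measurableSet_logArc b y), smul_eq_mul, ENNReal.toReal_mul,
      ENNReal.toReal_inv, ENNReal.toReal_ofReal hba.le, measureReal_def]
  have hlow : (1 - (10 : ℝ) ^ (-y)) / (9 / 10) ≤
      (b - a)⁻¹ * volume.real (logArc b y ∩ Ioo a b) := by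
    rw [inv_mul_eq_div, le_div_iff₀ hba]
    exact le_volume_real_logArc ha hab hy0 hy1
  linarith

/-- If `X` is uniformly distributed on an interval `(a, b)` with `0 ≤ a < b`, then the
Kolmogorov–Smirnov distance between the distribution of the fractional part of `log₁₀ X`
and the uniform distribution on `[0, 1)` is at least
`(−9 + ln 10 + 9 ln 9 − 9 ln ln 10) / (18 ln 10)`. -/
theorem uniform_not_benford_lower_bound
    {Ω : Type*} [MeasurableSpace Ω] (ℙ : Measure Ω) [IsProbabilityMeasure ℙ]
    (X : Ω → ℝ) (hXm : Measurable X) (a b : ℝ) (ha : 0 ≤ a) (hab : a < b)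
    (hX : Measure.map X ℙ = (ENNReal.ofReal (b - a))⁻¹ • volume.restrict (Ioo a b)) :
    (-9 + Real.log 10 + 9 * Real.log 9 - 9 * Real.log (Real.log 10)) / (18 * Real.log 10) ≤
      ksDist (Measure.map (fun ω => Int.fract (Real.logb 10 (X ω))) ℙ)
        (volume.restrict (Ico 0 1)) := by
  have hlog9 : Real.log 10 ≤ 9 := by
    linarith [Real.log_le_sub_one_of_pos (by norm_num : (0 : ℝ) < 10)]
  have hlog1 : 9 / 10 ≤ Real.log 10 := by
    linarith [Real.one_sub_inv_le_log_of_pos (by norm_num : (0 : ℝ) < 10)]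
  have hlog : 0 < Real.log 10 := by linarith
  set t : ℝ := 9 / 10 / Real.log 10 with ht
  have ht0 : 0 < t := by positivity
  have ht1 : t ≤ 1 := (div_le_one hlog).2 hlog1
  have ht2 : (10 : ℝ)⁻¹ ≤ t := by
    rw [ht, le_div_iff₀ hlog]
    linarith
  have hlogt : Real.log t = Real.log 9 - Real.log 10 - Real.log (Real.log 10) := by
    rw [ht, Real.log_div (by norm_num) hlog.ne', Real.log_div (by norm_num) (by norm_num)]
  have hy0 : 0 ≤ -Real.logb 10 t :=
    neg_nonneg.2 (Real.logb_nonpos (by norm_num) ht0.le ht1)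
  have hy1 : -Real.logb 10 t ≤ 1 := by
    have := Real.logb_le_logb_of_le (b := 10) (by norm_num) (by norm_num) ht2
    rw [Real.logb_inv, Real.logb_self_eq_one (by norm_num)] at this
    linarith
  have hmain := le_two_mul_ksDist_of_uniform ℙ X hXm a b ha hab hX _ hy0 hy1
  rw [neg_neg, Real.rpow_logb (by norm_num) (by norm_num) ht0] at hmain
  have hval : (1 - t) / (9 / 10) - -Real.logb 10 t =
      2 * ((-9 + Real.log 10 + 9 * Real.log 9 - 9 * Real.log (Real.log 10)) /
        (18 * Real.log 10)) := by
    rw [Real.logb, hlogt, ht]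
    field_simp
    ring
  linarith
end

section
/- The constant (−9 + ln 10 + 9·ln 9 − 9·ln(ln 10)) / (18·ln 10) is sharp: the infimum, over all random variables X uniformly distributed on some interval (a,b) with 0 ≤ a < b, of the Kolmogorov–Smirnov distance between the distribution of the fractional part of log₁₀ X and the uniform distribution on [0,1), equals (−9 + ln 10 + 9·ln 9 − 9·ln(ln 10)) / (18·ln 10). -/
open MeasureTheory Set

/-- The points of `[0, x)` whose base-10 mantissa is at most `q`. -/
def mantissaLE (q x : ℝ) : Set ℝ :=
  {y | Int.fract (Real.logb 10 y) ≤ Real.logb 10 q} ∩ Ico 0 x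

lemma measurable_fract_logb : Measurable fun y : ℝ => Int.fract (Real.logb 10 y) := by
  unfold Real.logb
  exact measurable_fract.comp (Real.measurable_log.div_const _)

lemma volume_real_inter_Ico_add {T : Set ℝ} {a b : ℝ} (ha : 0 ≤ a) (hab : a ≤ b) :
    volume.real (T ∩ Ico 0 a) + volume.real (T ∩ Ico a b) = volume.real (T ∩ Ico 0 b) := by
  have hne : ∀ c d : ℝ, volume (T ∩ Ico c d) ≠ ⊤ := fun c d =>
    measure_ne_top_of_subset inter_subset_right (by simp)
  have h := measureReal_inter_add_sdiff (μ := volume) (s := T ∩ Ico 0 b) (t := Ico 0 a)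
    measurableSet_Ico (hne 0 b)
  rw [← h]
  congr 2 <;> ext y <;> simp only [mem_inter_iff, mem_Ico, mem_sdiff] <;> grind

lemma fract_logb_ten_zpow_mul (k : ℤ) (y : ℝ) :
    Int.fract (Real.logb 10 ((10 : ℝ) ^ k * y)) = Int.fract (Real.logb 10 y) := by
  rcases eq_or_ne y 0 with rfl | hy
  · simp
  · rw [Real.logb_mul (by positivity) hy, ← Real.rpow_intCast,
      Real.logb_rpow (by norm_num) (by norm_num), Int.fract_intCast_add]

lemma volume_real_mantissaLE_zpow_mul (q x : ℝ) (k : ℤ) :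
    volume.real (mantissaLE q ((10 : ℝ) ^ k * x)) = (10 : ℝ) ^ k * volume.real (mantissaLE q x) := by
  have hk : (0 : ℝ) < (10 : ℝ) ^ k := by positivity
  have hpre : (fun y : ℝ => (10 : ℝ) ^ k * y) ⁻¹' mantissaLE q ((10 : ℝ) ^ k * x) =
      mantissaLE q x := by
    ext y
    simp only [mantissaLE, mem_preimage, mem_inter_iff, mem_ofPred_eq, mem_Ico,
      fract_logb_ten_zpow_mul, mul_lt_mul_iff_right₀ hk, mul_nonneg_iff_of_pos_left hk]
  have hvol := Real.volume_preimage_mul_left hk.ne' (mantissaLE q ((10 : ℝ) ^ k * x))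
  rw [hpre] at hvol
  rw [measureReal_def, measureReal_def, hvol, ENNReal.toReal_mul,
    ENNReal.toReal_ofReal (abs_nonneg _), abs_of_pos (by positivity)]
  field_simp

lemma volume_real_mantissa_inter_Ico_one {q z : ℝ} (hq : 1 ≤ q) (hz1 : 1 ≤ z) (hz : z ≤ 10) :
    volume.real ({y : ℝ | Int.fract (Real.logb 10 y) ≤ Real.logb 10 q} ∩ Ico 1 z) =
      min z q - 1 := by
  have hset : {y : ℝ | Int.fract (Real.logb 10 y) ≤ Real.logb 10 q} ∩ Ico 1 z =
      Iic q ∩ Ico 1 z := by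
    ext y
    simp only [mem_inter_iff, mem_ofPred_eq, mem_Iic, and_congr_left_iff, mem_Ico]
    rintro ⟨hy1, hyz⟩
    have hfr : Int.fract (Real.logb 10 y) = Real.logb 10 y :=
      Int.fract_eq_self.2 ⟨Real.logb_nonneg (by norm_num) hy1,
        (Real.logb_lt_iff_lt_rpow (by norm_num) (by linarith)).2 (by norm_num; linarith)⟩
    rw [hfr, Real.logb_le_logb (by norm_num) (by linarith) (by linarith)]
  rw [hset]
  rcases le_or_gt z q with h | h
  · rw [inter_eq_right.2 fun y hy => mem_Iic.2 (hy.2.le.trans h), min_eq_left h,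
      Real.volume_real_Ico_of_le hz1]
  · have : Iic q ∩ Ico 1 z = Icc 1 q := by
      ext y; simp only [mem_inter_iff, mem_Iic, mem_Ico, mem_Icc]; grind
    rw [this, min_eq_right h.le, Real.volume_real_Icc_of_le hq]

lemma volume_real_mantissaLE {q z : ℝ} (hq : 1 ≤ q) (hq10 : q ≤ 10) (hz1 : 1 ≤ z) (hz : z ≤ 10) :
    volume.real (mantissaLE q z) = (q - 1) / 9 + min z q - 1 := by
  have hstep : ∀ z : ℝ, 1 ≤ z → z ≤ 10 →
      volume.real (mantissaLE q 1) + (min z q - 1) = volume.real (mantissaLE q z) := by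
    intro z h1 h10
    rw [← volume_real_mantissa_inter_Ico_one hq h1 h10]
    exact volume_real_inter_Ico_add zero_le_one h1
  have h10 := hstep 10 (by norm_num) le_rfl
  have hscale := volume_real_mantissaLE_zpow_mul q 1 1
  rw [min_eq_right hq10] at h10
  norm_num at hscale
  linarith [hstep z hz1 hz]

lemma exists_zpow_mul {x : ℝ} (hx : 0 < x) :
    ∃ (k : ℤ) (z : ℝ), 1 ≤ z ∧ z < 10 ∧ x = (10 : ℝ) ^ k * z := by
  obtain ⟨k, hk1, hk2⟩ := exists_mem_Ico_zpow hx (by norm_num : (1 : ℝ) < 10)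
  have hk : (0 : ℝ) < (10 : ℝ) ^ k := by positivity
  refine ⟨k, x / 10 ^ k, (one_le_div hk).2 hk1, ?_, by field_simp⟩
  rw [div_lt_iff₀ hk]
  rwa [zpow_add_one₀ (by norm_num), mul_comm] at hk2

/-- The law of the fractional part of `log₁₀ X` for `X` uniform on `(a, b)`. -/
noncomputable def uniformMantissaLaw (a b : ℝ) : Measure ℝ :=
  Measure.map (fun x => Int.fract (Real.logb 10 x))
    ((ENNReal.ofReal (b - a))⁻¹ • volume.restrict (Ioo a b))

lemma uniformMantissaLaw_apply {a b : ℝ} (hab : a < b) {S : Set ℝ} (hS : MeasurableSet S) :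
    (uniformMantissaLaw a b S).toReal =
      volume.real ((fun x => Int.fract (Real.logb 10 x)) ⁻¹' S ∩ Ico a b) / (b - a) := by
  rw [uniformMantissaLaw, Measure.map_apply measurable_fract_logb hS, Measure.smul_apply,
    restrict_Ioo_eq_restrict_Ico, Measure.restrict_apply (measurable_fract_logb hS), smul_eq_mul,
    ENNReal.toReal_mul, ENNReal.toReal_inv, ENNReal.toReal_ofReal (by linarith),
    ← measureReal_def, div_eq_inv_mul]

lemma uniformMantissaLaw_Iic_logb {a b : ℝ} (ha : 0 ≤ a) (hab : a < b) (q : ℝ) :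
    (uniformMantissaLaw a b (Iic (Real.logb 10 q))).toReal =
      (volume.real (mantissaLE q b) - volume.real (mantissaLE q a)) / (b - a) := by
  rw [uniformMantissaLaw_apply hab measurableSet_Iic, mantissaLE, mantissaLE,
    ← volume_real_inter_Ico_add ha hab.le, add_sub_cancel_left]
  rfl

lemma uniformMantissaLaw_Iic_le_one {a b : ℝ} (hab : a < b) (x : ℝ) :
    (uniformMantissaLaw a b (Iic x)).toReal ≤ 1 := by
  rw [uniformMantissaLaw_apply hab measurableSet_Iic, div_le_one (by linarith),
    ← Real.volume_real_Ico_of_le hab.le]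
  exact measureReal_mono inter_subset_right (by simp)

lemma uniformMantissaLaw_Iic_of_neg {a b x : ℝ} (hab : a < b) (hx : x < 0) :
    (uniformMantissaLaw a b (Iic x)).toReal = 0 := by
  rw [uniformMantissaLaw_apply hab measurableSet_Iic]
  have : (fun x => Int.fract (Real.logb 10 x)) ⁻¹' Iic x = ∅ :=
    eq_empty_of_forall_notMem fun y hy => absurd (Int.fract_nonneg (Real.logb 10 y))
      (not_le.2 (lt_of_le_of_lt hy hx))
  simp [this]

lemma uniformMantissaLaw_Iic_of_one_le {a b x : ℝ} (hab : a < b) (hx : 1 ≤ x) :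
    (uniformMantissaLaw a b (Iic x)).toReal = 1 := by
  rw [uniformMantissaLaw_apply hab measurableSet_Iic]
  have : (fun x => Int.fract (Real.logb 10 x)) ⁻¹' Iic x = univ :=
    eq_univ_of_forall fun y => (Int.fract_lt_one (Real.logb 10 y)).le.trans hx
  rw [this, univ_inter, Real.volume_real_Ico_of_le hab.le, div_self (by linarith)]

lemma restrict_Ico_Iic_toReal (x : ℝ) :
    ((volume.restrict (Ico (0 : ℝ) 1)) (Iic x)).toReal = max 0 (min x 1) := by
  rw [restrict_Ico_eq_restrict_Icc, Measure.restrict_apply measurableSet_Iic]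
  have : Iic x ∩ Icc (0 : ℝ) 1 = Icc 0 (min x 1) := by
    ext y; simp only [mem_inter_iff, mem_Iic, mem_Icc, le_min_iff]; tauto
  rw [this, ← measureReal_def, Real.volume_real_Icc, sub_zero, max_comm]

lemma le_ksDist_uniformMantissaLaw {a b : ℝ} (hab : a < b) (x : ℝ) :
    |(uniformMantissaLaw a b (Iic x)).toReal - ((volume.restrict (Ico (0 : ℝ) 1)) (Iic x)).toReal| ≤
      ksDist (uniformMantissaLaw a b) (volume.restrict (Ico 0 1)) := by
  refine le_ciSup (f := fun x => |(uniformMantissaLaw a b (Iic x)).toReal -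
    ((volume.restrict (Ico (0 : ℝ) 1)) (Iic x)).toReal|) ⟨1, ?_⟩ x
  rintro _ ⟨y, rfl⟩
  have h1 := uniformMantissaLaw_Iic_le_one hab y
  have h2 : 0 ≤ (uniformMantissaLaw a b (Iic y)).toReal := ENNReal.toReal_nonneg
  have h3 : max 0 (min y 1) ≤ 1 := max_le zero_le_one (min_le_right _ _)
  have h4 := le_max_left 0 (min y 1)
  simp only [restrict_Ico_Iic_toReal]
  rw [abs_le]
  constructor <;> linarith

lemma volume_restrict_Ico_Iic_logb {q : ℝ} (hq1 : 1 ≤ q) (hq : q < 10) :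
    ((volume.restrict (Ico (0 : ℝ) 1)) (Iic (Real.logb 10 q))).toReal = Real.logb 10 q := by
  rw [restrict_Ico_Iic_toReal]
  have h0 : 0 ≤ Real.logb 10 q := Real.logb_nonneg (by norm_num) hq1
  have h1 : Real.logb 10 q < 1 :=
    (Real.logb_lt_iff_lt_rpow (by norm_num) (by linarith)).2 (by simpa using hq)
  rw [min_eq_left h1.le, max_eq_right h0]

/-- Twice the Kolmogorov–Smirnov distance is at least any gap between the deviations of the
two distribution functions at two points of `[0, 1)`. -/
lemma two_mul_ksDist_ge {a b p q : ℝ} (hab : a < b) (hp1 : 1 ≤ p) (hp : p < 10)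
    (hq1 : 1 ≤ q) (hq : q < 10) :
    ((uniformMantissaLaw a b (Iic (Real.logb 10 q))).toReal - Real.logb 10 q) -
      ((uniformMantissaLaw a b (Iic (Real.logb 10 p))).toReal - Real.logb 10 p) ≤
      2 * ksDist (uniformMantissaLaw a b) (volume.restrict (Ico 0 1)) := by
  have h1 := le_ksDist_uniformMantissaLaw hab (Real.logb 10 q)
  have h2 := le_ksDist_uniformMantissaLaw hab (Real.logb 10 p)
  rw [volume_restrict_Ico_Iic_logb hq1 hq] at h1
  rw [volume_restrict_Ico_Iic_logb hp1 hp] at h2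
  linarith [le_abs_self ((uniformMantissaLaw a b (Iic (Real.logb 10 q))).toReal - Real.logb 10 q),
    neg_abs_le ((uniformMantissaLaw a b (Iic (Real.logb 10 p))).toReal - Real.logb 10 p)]

lemma mantissaLE_zero (q : ℝ) : mantissaLE q 0 = ∅ := by simp [mantissaLE]

/-- Suppose the arc from `log₁₀ p` to `log₁₀ q`, with `e = 1` if it wraps around and `e = 0`
otherwise, fills at most the proportion `r` of every initial segment `[0, z)`, and exactly `r` of
`[0, b)`. Then the uniform law on `(a, b)` gives the arc mass at least `r`. -/
lemma uniformMantissaLaw_arc_ge {a b p q y r e : ℝ} {k : ℤ} (ha : 0 ≤ a) (hab : a < b)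
    (hb : b = (10 : ℝ) ^ k * y) (hy1 : 1 ≤ y) (hy : y ≤ 10)
    (hp1 : 1 ≤ p) (hp : p ≤ 10) (hq1 : 1 ≤ q) (hq : q ≤ 10)
    (heq : (q - 1) / 9 + min y q - ((p - 1) / 9 + min y p) + e * y = r * y)
    (hle : ∀ z, 1 ≤ z → z ≤ 10 →
      (q - 1) / 9 + min z q - ((p - 1) / 9 + min z p) + e * z ≤ r * z) :
    r - e ≤ (uniformMantissaLaw a b (Iic (Real.logb 10 q))).toReal -
      (uniformMantissaLaw a b (Iic (Real.logb 10 p))).toReal := by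
  have hval : ∀ (k : ℤ) (z : ℝ), 1 ≤ z → z ≤ 10 →
      volume.real (mantissaLE q ((10 : ℝ) ^ k * z)) - volume.real (mantissaLE p ((10 : ℝ) ^ k * z)) =
        (10 : ℝ) ^ k * ((q - 1) / 9 + min z q - ((p - 1) / 9 + min z p)) := by
    intro k z hz1 hz
    rw [volume_real_mantissaLE_zpow_mul, volume_real_mantissaLE_zpow_mul,
      volume_real_mantissaLE hq1 hq hz1 hz, volume_real_mantissaLE hp1 hp hz1 hz]
    ring
  have hB : volume.real (mantissaLE q b) - volume.real (mantissaLE p b) = (r - e) * b := by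
    rw [hb, hval k y hy1 hy]
    linear_combination (10 : ℝ) ^ k * heq
  have hA : volume.real (mantissaLE q a) - volume.real (mantissaLE p a) ≤ (r - e) * a := by
    rcases ha.eq_or_lt with rfl | ha0
    · simp [mantissaLE_zero]
    · obtain ⟨m, z, hz1, hz, rfl⟩ := exists_zpow_mul ha0
      rw [hval m z hz1 hz.le]
      have := mul_le_mul_of_nonneg_left (hle z hz1 hz.le) (by positivity : (0 : ℝ) ≤ (10 : ℝ) ^ m)
      linarith
  rw [uniformMantissaLaw_Iic_logb ha hab, uniformMantissaLaw_Iic_logb ha hab, ← sub_div,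
    le_div_iff₀ (by linarith)]
  linarith

/-- The arc of logarithmic length `log₁₀ w` ending at `log₁₀ b` shows that the law is far from
uniform. -/
lemma le_two_mul_ksDist {a b w : ℝ} (ha : 0 ≤ a) (hab : a < b) (hw1 : 1 < w) (hw : w < 10) :
    10 / 9 * (1 - 1 / w) - Real.logb 10 w ≤
      2 * ksDist (uniformMantissaLaw a b) (volume.restrict (Ico 0 1)) := by
  obtain ⟨k, y, hy1, hy, hb⟩ := exists_zpow_mul (ha.trans_lt hab)
  have hy0 : 0 < y := by linarith
  have hw0 : 0 < w := by linarith
  obtain ⟨u, hu⟩ : ∃ u, u = y / w := ⟨_, rfl⟩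
  have hyu : y = w * u := by rw [hu]; field_simp
  have hu0 : 0 < u := by rw [hu]; positivity
  have huy : u < y := by rw [hyu]; nlinarith
  have hyu10 : y < 10 * u := by rw [hyu]; nlinarith
  have hr : ∀ z : ℝ, 10 / 9 * (1 - 1 / w) * z = 10 / 9 * (1 - u / y) * z := by
    intro z; rw [hyu]; field_simp
  have hlog : Real.logb 10 u = Real.logb 10 y - Real.logb 10 w := by
    rw [hu, Real.logb_div hy0.ne' hw0.ne']
  have hratio : ∀ z : ℝ, u / y * z * y = u * z := by intro z; field_simp
  rcases le_or_gt 1 u with h1 | h1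
  · have hu10 : u < 10 := by linarith
    have key := uniformMantissaLaw_arc_ge (p := u) (q := y) (r := 10 / 9 * (1 - 1 / w)) (e := 0)
      ha hab hb hy1 hy.le h1 hu10.le hy1 hy.le
      (by rw [hr, min_self, min_eq_right huy.le]; field_simp; ring)
      (by
        intro z hz1 hz
        have hmul : 10 / 9 * (1 - u / y) * z * y = 10 / 9 * (y - u) * z := by field_simp
        rw [hr, ← mul_le_mul_iff_left₀ hy0, hmul]
        rcases le_total z u with hzu | hzu
        · rw [min_eq_left hzu, min_eq_left (hzu.trans huy.le)]
          nlinarith [mul_nonneg (sub_nonneg.2 huy.le) (by linarith : 0 ≤ 10 * z - y)]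
        rw [min_eq_right hzu]
        rcases le_total z y with hzy | hzy
        · rw [min_eq_left hzy]
          nlinarith [mul_nonneg (sub_nonneg.2 hyu10.le) (sub_nonneg.2 hzy)]
        · rw [min_eq_right hzy]
          nlinarith [mul_nonneg (sub_nonneg.2 huy.le) (sub_nonneg.2 hzy)])
    have := two_mul_ksDist_ge hab h1 hu10 hy1 hy
    linarith
  · have h10u : 10 * u < 10 := by linarith
    have hlog10 : Real.logb 10 (10 * u) = 1 + Real.logb 10 u := by
      rw [Real.logb_mul (by norm_num) hu0.ne', Real.logb_self_eq_one (by norm_num)]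
    have key := uniformMantissaLaw_arc_ge (p := 10 * u) (q := y) (r := 10 / 9 * (1 - 1 / w))
      (e := 1) ha hab hb hy1 hy.le (by linarith) h10u.le hy1 hy.le
      (by rw [hr, min_self, min_eq_left hyu10.le]; field_simp; ring)
      (by
        intro z hz1 hz
        have hmul : 10 / 9 * (1 - u / y) * z * y = 10 / 9 * (y - u) * z := by field_simp
        rw [hr, ← mul_le_mul_iff_left₀ hy0, hmul]
        rcases le_total z y with hzy | hzy
        · rw [min_eq_left hzy, min_eq_left (hzy.trans hyu10.le)]
          nlinarith [mul_nonneg (sub_nonneg.2 hyu10.le) (sub_nonneg.2 hzy)]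
        rw [min_eq_right hzy]
        rcases le_total z (10 * u) with hzu | hzu
        · rw [min_eq_left hzu]
          nlinarith [mul_nonneg (sub_nonneg.2 huy.le) (sub_nonneg.2 hzy)]
        · rw [min_eq_right hzu]
          nlinarith [mul_nonneg (sub_nonneg.2 hyu10.le) (by linarith : 0 ≤ 10 * y - z)])
    have := two_mul_ksDist_ge hab (by linarith) h10u hy1 hy
    linarith

/-- The cumulative distribution function for `X` uniform on `(0, t)`. -/
lemma uniformMantissaLaw_zero_Iic {t y : ℝ} (ht1 : 1 ≤ t) (ht : t ≤ 10) (hy1 : 1 ≤ y)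
    (hy : y ≤ 10) :
    (uniformMantissaLaw 0 t (Iic (Real.logb 10 y))).toReal = ((y - 1) / 9 + min t y - 1) / t := by
  rw [uniformMantissaLaw_Iic_logb le_rfl (by linarith), mantissaLE_zero,
    volume_real_mantissaLE hy1 hy ht1 ht]
  simp

lemma mul_sub_log_le_max {α β m x y z : ℝ} (hx : 0 < x) (hxy : x ≤ y) (hyz : y ≤ z)
    (h1 : α * x + β - Real.log x ≤ m) (h2 : α * z + β - Real.log z ≤ m) :
    α * y + β - Real.log y ≤ m := by
  rcases hxy.eq_or_lt with rfl | hxy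
  · exact h1
  rcases hyz.eq_or_lt with rfl | hyz
  · exact h2
  have hslope := strictConcaveOn_log_Ioi.concaveOn.slope_anti_adjacent (mem_Ioi.2 hx)
    (mem_Ioi.2 (by linarith)) hxy hyz
  rw [div_le_div_iff₀ (by linarith) (by linarith)] at hslope
  have h1' := mul_le_mul_of_nonneg_left h1 (by linarith : 0 ≤ z - y)
  have h2' := mul_le_mul_of_nonneg_left h2 (by linarith : 0 ≤ y - x)
  refine le_of_mul_le_mul_left ?_ (by linarith : 0 < z - x)
  linarith

lemma logb_ten_eq (y : ℝ) : Real.logb 10 y = Real.log y / Real.log 10 := rfl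

lemma one_lt_ten_mul_log_ten_div_nine_and_lt_ten : 1 < 10 * Real.log 10 / 9 ∧ 10 * Real.log 10 / 9 < 10 := by
  have h1 := Real.log_lt_sub_one_of_pos (by norm_num : (0 : ℝ) < 10) (by norm_num)
  have h2 := Real.log_lt_sub_one_of_pos (by norm_num : (0 : ℝ) < 10⁻¹) (by norm_num)
  rw [Real.log_inv] at h2
  constructor <;> linarith

/-- If the deviation at `log₁₀ t` is half the circular discrepancy, then the uniform law on
`(0, t)` is within that half of Benford's law. -/
lemma abs_deviation_le {t y C : ℝ} (ht1 : 1 ≤ t)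
    (hC : 2 * C = 1 / 9 - 1 / Real.log 10 + Real.logb 10 (9 / Real.log 10)) (hC0 : 0 ≤ C)
    (hh : 10 / 9 * (1 - 1 / t) - Real.logb 10 t = C) (hy1 : 1 ≤ y) (hy : y ≤ 10) :
    |((y - 1) / 9 + min t y - 1) / t - Real.logb 10 y| ≤ C := by
  have hK : 0 < Real.log 10 := Real.log_pos (by norm_num)
  have ht0 : 0 < t := by linarith
  have hy0 : 0 < y := by linarith
  have hmul : ∀ x v : ℝ, x - Real.logb 10 v = (x * Real.log 10 - Real.log v) / Real.log 10 := by
    intro x v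
    rw [logb_ten_eq]
    field_simp
  have htangent : ∀ s : ℝ, 0 < s →
      Real.logb 10 y ≤ y / (s * Real.log 10) - 1 / Real.log 10 + Real.logb 10 s := by
    intro s hs
    have h := Real.log_le_sub_one_of_pos (div_pos hy0 hs)
    rw [Real.log_div hy0.ne' hs.ne'] at h
    rw [logb_ten_eq, logb_ten_eq, ← sub_nonneg]
    have : y / (s * Real.log 10) - 1 / Real.log 10 + Real.log s / Real.log 10 -
        Real.log y / Real.log 10 = (y / s - 1 - (Real.log y - Real.log s)) / Real.log 10 := by
      field_simp
      ring
    rw [this]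
    exact div_nonneg (by linarith) hK.le
  have hlogt : Real.logb 10 (9 * t / Real.log 10) =
      Real.logb 10 t + Real.logb 10 (9 / Real.log 10) := by
    rw [← Real.logb_mul ht0.ne' (by positivity)]
    congr 1
    ring
  have hlogt' : Real.logb 10 (9 * t / Real.log 10 / 10) =
      Real.logb 10 t + Real.logb 10 (9 / Real.log 10) - 1 := by
    rw [Real.logb_div (by positivity) (by norm_num), hlogt, Real.logb_self_eq_one (by norm_num)]
  have hh' : 10 / 9 * (1 - 1 / t) * Real.log 10 - Real.log t = C * Real.log 10 := by
    rw [← hh, logb_ten_eq]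
    field_simp
  have hCK : 0 ≤ C * Real.log 10 := by positivity
  rw [abs_le]
  rcases le_total y t with hyt | hyt
  · rw [min_eq_right hyt]
    constructor
    · have h := htangent (9 * t / Real.log 10 / 10) (by positivity)
      rw [hlogt'] at h
      have e1 : y / (9 * t / Real.log 10 / 10 * Real.log 10) = 10 / 9 * (y / t) := by field_simp
      have e2 : ((y - 1) / 9 + y - 1) / t = 10 / 9 * (y / t) - 10 / 9 * (1 / t) := by
        field_simp; ring
      rw [e1] at h
      rw [e2]
      linarith
    · rw [hmul, div_le_iff₀ hK]
      have h := mul_sub_log_le_max (α := 10 / (9 * t) * Real.log 10)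
        (β := -(10 / (9 * t) * Real.log 10)) (m := C * Real.log 10) one_pos hy1 hyt
        (by simpa using hCK) (by rw [← hh']; apply le_of_eq; field_simp; ring)
      rw [sub_le_iff_le_add] at h ⊢
      refine le_of_eq_of_le ?_ h
      field_simp
      ring
  · rw [min_eq_left hyt]
    constructor
    · have h := htangent (9 * t / Real.log 10) (by positivity)
      rw [hlogt] at h
      have e1 : y / (9 * t / Real.log 10 * Real.log 10) = 1 / 9 * (y / t) := by field_simp
      have e2 : ((y - 1) / 9 + t - 1) / t = 1 / 9 * (y / t) + 1 - 10 / 9 * (1 / t) := by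
        field_simp; ring
      rw [e1] at h
      rw [e2]
      linarith
    · rw [hmul, div_le_iff₀ hK]
      have h := mul_sub_log_le_max (α := 1 / (9 * t) * Real.log 10)
        (β := (1 - 10 / (9 * t)) * Real.log 10) (m := C * Real.log 10) ht0 hyt hy
        (by rw [← hh']; apply le_of_eq; field_simp; ring)
        (by refine le_trans (le_of_eq ?_) hCK; field_simp; ring)
      rw [sub_le_iff_le_add] at h ⊢
      refine le_of_eq_of_le ?_ h
      field_simp
      ring

/-- The constant `(−9 + ln 10 + 9 ln 9 − 9 ln ln 10) / (18 ln 10)` is sharp: it is the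
infimum (greatest lower bound), over all random variables `X` uniformly distributed on some
interval `(a, b)` with `0 ≤ a < b`, of the Kolmogorov–Smirnov distance between the
distribution of the fractional part of `log₁₀ X` and the uniform distribution on `[0, 1)`. -/
theorem uniform_not_benford_bound_sharp :
    IsGLB { d : ℝ | ∃ a b : ℝ, 0 ≤ a ∧ a < b ∧
        d = ksDist
          (Measure.map (fun x => Int.fract (Real.logb 10 x))
            ((ENNReal.ofReal (b - a))⁻¹ • volume.restrict (Ioo a b)))
          (volume.restrict (Ico 0 1)) }
      ((-9 + Real.log 10 + 9 * Real.log 9 - 9 * Real.log (Real.log 10)) /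
        (18 * Real.log 10)) := by
  set C := (-9 + Real.log 10 + 9 * Real.log 9 - 9 * Real.log (Real.log 10)) /
    (18 * Real.log 10) with hCdef
  have hK : 0 < Real.log 10 := Real.log_pos (by norm_num)
  obtain ⟨hw1, hw⟩ := one_lt_ten_mul_log_ten_div_nine_and_lt_ten
  set w := 10 * Real.log 10 / 9 with hwdef
  have hlogw : Real.logb 10 w = 1 + (Real.log (Real.log 10) - Real.log 9) / Real.log 10 := by
    rw [hwdef, logb_ten_eq, Real.log_div (by positivity) (by norm_num),
      Real.log_mul (by norm_num) hK.ne']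
    field_simp
    ring
  have hCw : 10 / 9 * (1 - 1 / w) - Real.logb 10 w = 2 * C := by
    rw [hlogw, hCdef, hwdef]
    field_simp
    ring
  have hC : 2 * C = 1 / 9 - 1 / Real.log 10 + Real.logb 10 (9 / Real.log 10) := by
    rw [logb_ten_eq, Real.log_div (by norm_num) hK.ne', hCdef]
    field_simp
    ring
  have hC0 : 0 ≤ C := by
    have h : 2 * C * Real.log 10 = w - 1 - Real.log w := by
      rw [← hCw, logb_ten_eq, hwdef]
      field_simp
    have := Real.log_le_sub_one_of_pos (by linarith : 0 < w)
    nlinarith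
  have hlower : ∀ a b : ℝ, 0 ≤ a → a < b →
      C ≤ ksDist (uniformMantissaLaw a b) (volume.restrict (Ico 0 1)) := by
    intro a b ha hab
    linarith [le_two_mul_ksDist ha hab hw1 hw]
  obtain ⟨t, ⟨ht1, htw⟩, ht⟩ : ∃ t ∈ Icc 1 w, 10 / 9 * (1 - 1 / t) - Real.logb 10 t = C := by
    refine intermediate_value_Icc (f := fun t => 10 / 9 * (1 - 1 / t) - Real.logb 10 t) hw1.le ?_
      ⟨by simpa using hC0, by linarith⟩
    intro t ht
    have ht0 : t ≠ 0 := by linarith [ht.1]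
    refine ContinuousAt.continuousWithinAt ?_
    simp only [logb_ten_eq]
    fun_prop (disch := assumption)
  refine IsLeast.isGLB ⟨⟨0, t, le_rfl, by linarith, ?_⟩, ?_⟩
  · refine le_antisymm (hlower 0 t le_rfl (by linarith)) (ciSup_le fun x => ?_)
    change |(uniformMantissaLaw 0 t (Iic x)).toReal - _| ≤ C
    have ht0 : 0 < t := by linarith
    rcases lt_or_ge x 0 with hx0 | hx0
    · rw [uniformMantissaLaw_Iic_of_neg ht0 hx0, restrict_Ico_Iic_toReal,
        max_eq_left ((min_le_left _ _).trans hx0.le)]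
      simpa using hC0
    rcases le_or_gt 1 x with hx1 | hx1
    · rw [uniformMantissaLaw_Iic_of_one_le ht0 hx1, restrict_Ico_Iic_toReal, min_eq_right hx1]
      simpa using hC0
    have hx : x = Real.logb 10 ((10 : ℝ) ^ x) :=
      (Real.logb_rpow (by norm_num) (by norm_num)).symm
    have hy1 : (1 : ℝ) ≤ (10 : ℝ) ^ x := Real.one_le_rpow (by norm_num) hx0
    have hy : (10 : ℝ) ^ x < 10 := by
      simpa using Real.rpow_lt_rpow_of_exponent_lt (by norm_num : (1 : ℝ) < 10) hx1
    rw [hx, volume_restrict_Ico_Iic_logb hy1 hy,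
      uniformMantissaLaw_zero_Iic ht1 (by linarith) hy1 hy.le]
    exact abs_deviation_le ht1 hC hC0 ht hy1 hy.le
  · rintro _ ⟨a, b, ha, hab, rfl⟩
    exact hlower a b ha hab
end

section
/- No positive uniformly distributed random variable is Benford: if X is uniformly distributed on an interval (a,b) with 0 ≤ a < b, then the distribution of the fractional part of log₁₀ X is not the uniform distribution on [0,1). -/
open MeasureTheory Set

/-- Multiplication by `10 ^ δ` shifts the fractional part of `log₁₀` by `δ`, as long as the shifted
value stays below `1`. -/
lemma fract_logb_rpow_mul {x δ : ℝ} (hx : 0 < x) (hδ : 0 ≤ δ)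
    (h : Int.fract (Real.logb 10 x) + δ < 1) :
    Int.fract (Real.logb 10 ((10 : ℝ) ^ δ * x)) = Int.fract (Real.logb 10 x) + δ := by
  rw [Real.logb_mul (by positivity) hx.ne', Real.logb_rpow (by norm_num) (by norm_num),
    Int.fract_eq_iff]
  refine ⟨add_nonneg (Int.fract_nonneg _) hδ, h, ⌊Real.logb 10 x⌋, ?_⟩
  linarith [Int.floor_add_fract (Real.logb 10 x)]

/-- A point below `b` whose `log₁₀` has larger fractional part than that of `b` stays below `b`
when multiplied by `10 ^ δ`, provided the fractional part does not wrap around. -/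
lemma rpow_mul_lt_of_fract_logb_lt {x b δ : ℝ} (hx : 0 < x) (hxb : x < b)
    (hfract : Int.fract (Real.logb 10 b) < Int.fract (Real.logb 10 x))
    (h : Int.fract (Real.logb 10 x) + δ < 1) : (10 : ℝ) ^ δ * x < b := by
  by_contra! hb
  have hlog : Real.logb 10 x < Real.logb 10 b :=
    Real.logb_lt_logb (by norm_num) hx hxb
  have hlog' : Real.logb 10 b ≤ δ + Real.logb 10 x := by
    rw [← Real.logb_rpow (b := 10) (x := δ) (by norm_num) (by norm_num),
      ← Real.logb_mul (by positivity) hx.ne']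
    exact Real.logb_le_logb_of_le (by norm_num) (hx.trans hxb) hb
  have hfloor : ⌊Real.logb 10 b⌋ = ⌊Real.logb 10 x⌋ := by
    rw [Int.floor_eq_iff]
    constructor <;>
      linarith [Int.floor_add_fract (Real.logb 10 x), Int.fract_nonneg (Real.logb 10 x)]
  have hb' := Int.floor_add_fract (Real.logb 10 b)
  rw [hfloor] at hb'
  linarith [Int.floor_add_fract (Real.logb 10 x)]

/-- No positive uniformly distributed random variable is Benford: if `X` is uniformly
distributed on an interval `(a, b)` with `0 ≤ a < b`, then the distribution of the
fractional part of `log₁₀ X` is not the uniform distribution on `[0, 1)`. -/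
theorem uniform_not_benford
    {Ω : Type*} [MeasurableSpace Ω] (ℙ : Measure Ω) [IsProbabilityMeasure ℙ]
    (X : Ω → ℝ) (hXm : Measurable X) (a b : ℝ) (ha : 0 ≤ a) (hab : a < b)
    (hX : Measure.map X ℙ = (ENNReal.ofReal (b - a))⁻¹ • volume.restrict (Ioo a b)) :
    Measure.map (fun ω => Int.fract (Real.logb 10 (X ω))) ℙ ≠
      volume.restrict (Ico 0 1) := by
  intro hben
  set f : ℝ → ℝ := fun x => Int.fract (Real.logb 10 x) with hf
  have hfm : Measurable f := measurable_fract.comp (by unfold Real.logb; fun_prop)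
  have hβ0 : 0 ≤ f b := Int.fract_nonneg _
  have hβ1 : f b < 1 := Int.fract_lt_one _
  set δ : ℝ := (1 - f b) / 2 with hδ
  have hδ0 : 0 < δ := by linarith
  have hvol (s t : ℝ) (hs : 0 ≤ s) (ht : t ≤ 1) :
      (ENNReal.ofReal (b - a))⁻¹ * volume (f ⁻¹' Ioo s t ∩ Ioo a b) = ENNReal.ofReal (t - s) := by
    have h := congrArg (fun μ : Measure ℝ => μ (Ioo s t)) hben
    change Measure.map (f ∘ X) ℙ (Ioo s t) = _ at h
    rw [← Measure.map_map hfm hXm, hX, Measure.map_apply hfm measurableSet_Ioo,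
      Measure.smul_apply, Measure.restrict_apply (hfm measurableSet_Ioo),
      Measure.restrict_apply measurableSet_Ioo,
      inter_eq_left.2 (Ioo_subset_Ico_self.trans (Ico_subset_Ico hs ht)), Real.volume_Ioo] at h
    exact h
  have hlow := hvol (f b) (f b + δ) hβ0 (by linarith)
  have hupp := hvol (f b + δ) 1 (by linarith) le_rfl
  have hsub : (fun x => (10 : ℝ) ^ δ * x) '' (f ⁻¹' Ioo (f b) (f b + δ) ∩ Ioo a b) ⊆
      f ⁻¹' Ioo (f b + δ) 1 ∩ Ioo a b := by
    rintro _ ⟨x, ⟨⟨hx1, hx2⟩, hxa, hxb⟩, rfl⟩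
    have hx0 : 0 < x := ha.trans_lt hxa
    have hwrap : f x + δ < 1 := by linarith
    have hshift : f ((10 : ℝ) ^ δ * x) = f x + δ := fract_logb_rpow_mul hx0 hδ0.le hwrap
    refine ⟨⟨by rw [hshift]; linarith, by rwa [hshift]⟩, ?_,
      rpow_mul_lt_of_fract_logb_lt hx0 hxb hx1 hwrap⟩
    exact hxa.trans_le (le_mul_of_one_le_left hx0.le
      (Real.one_le_rpow (by norm_num) hδ0.le))
  have hle : ENNReal.ofReal ((10 : ℝ) ^ δ) * ENNReal.ofReal δ ≤ ENNReal.ofReal δ := by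
    have h := measure_mono (μ := volume) hsub
    have himage := Measure.addHaar_smul (volume : Measure ℝ) ((10 : ℝ) ^ δ)
      (f ⁻¹' Ioo (f b) (f b + δ) ∩ Ioo a b)
    rw [Module.finrank_self, pow_one, abs_of_pos (by positivity)] at himage
    replace h := himage.symm.trans_le h
    replace h := mul_le_mul_right h (ENNReal.ofReal (b - a))⁻¹
    rwa [mul_left_comm, hlow, hupp, add_sub_cancel_left,
      show 1 - (f b + δ) = δ by linarith] at h
  rw [← ENNReal.ofReal_mul (by positivity), ENNReal.ofReal_le_ofReal_iff hδ0.le] at hle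
  have h10 : 1 < (10 : ℝ) ^ δ := Real.one_lt_rpow (by norm_num) hδ0
  nlinarith
end

section
/- For every integer k ≥ 1, let X_k be a random variable with probability density 1/(x·ln 10) on the interval (10^k, 10^{k+1}) (and density 0 elsewhere). Then log₁₀ X_k, although a positive random variable, is not itself Benford: the distribution of the fractional part of log₁₀(log₁₀ X_k) is not the uniform distribution on [0,1). -/
open MeasureTheory Set

/-- For every integer `k ≥ 1`, if `X` has probability density `1/(x ln 10)` on the interval
`(10^k, 10^{k+1})` (and `0` elsewhere), then `log₁₀ X`, although a positive random
variable, is not itself Benford: the distribution of the fractional part of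
`log₁₀ (log₁₀ X)` is not the uniform distribution on `[0, 1)`. -/
theorem log_of_benford_not_benford
    {Ω : Type*} [MeasurableSpace Ω] (ℙ : Measure Ω) [IsProbabilityMeasure ℙ]
    (k : ℤ) (hk : 1 ≤ k) (X : Ω → ℝ) (hXm : Measurable X)
    (hX : Measure.map X ℙ = volume.withDensity
      (Set.indicator (Ioo ((10 : ℝ) ^ k) ((10 : ℝ) ^ (k + 1)))
        (fun x => ENNReal.ofReal (1 / (x * Real.log 10))))) :
    Measure.map (fun ω => Int.fract (Real.logb 10 (Real.logb 10 (X ω)))) ℙ ≠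
      volume.restrict (Ico 0 1) := by
  intro h
  set a : ℝ := Real.logb 10 k with ha
  set b : ℝ := Real.logb 10 (k + 1) with hb
  set S : Set ℝ := Ioo (a - ⌊a⌋) (b - ⌊a⌋) ∪ Ioo (a - ⌊a⌋ - 1) (b - ⌊a⌋ - 1) with hS
  have hk' : (1 : ℝ) ≤ k := by exact_mod_cast hk
  have hab : 2 * (b - a) < 1 := by
    rw [hb, ha, ← Real.logb_div (by positivity) (by positivity)]
    have h2 : Real.logb 10 ((k + 1 : ℝ) / k) ≤ Real.logb 10 2 := by
      apply Real.logb_le_logb_of_le (by norm_num) (by positivity)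
      rw [div_le_iff₀ (by positivity)]
      linarith
    have h4 : 2 * Real.logb 10 2 < 1 := by
      have : 2 * Real.logb 10 2 = Real.logb 10 ((2 : ℝ) ^ (2 : ℕ)) := by
        rw [Real.logb_pow]; norm_num
      rw [this, Real.logb_lt_iff_lt_rpow (by norm_num) (by norm_num)]
      norm_num
    linarith
  have hle : a ≤ b := Real.logb_le_logb_of_le (by norm_num) (by positivity) (by linarith)
  have hmem : ∀ᵐ x ∂(Measure.map X ℙ), x ∈ Ioo ((10 : ℝ) ^ k) ((10 : ℝ) ^ (k + 1)) := by
    rw [hX, withDensity_indicator measurableSet_Ioo]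
    exact (withDensity_absolutelyContinuous _ _).ae_le (ae_restrict_mem measurableSet_Ioo)
  have hfm : Measurable fun ω => Int.fract (Real.logb 10 (Real.logb 10 (X ω))) := by
    unfold Real.logb
    fun_prop
  have hSm : MeasurableSet S := measurableSet_Ioo.union measurableSet_Ioo
  have hfS : ∀ᵐ ω ∂ℙ, Int.fract (Real.logb 10 (Real.logb 10 (X ω))) ∈ S := by
    filter_upwards [ae_of_ae_map hXm.aemeasurable hmem] with ω ⟨h1, h2⟩
    have hX0 : 0 < X ω := lt_trans (by positivity) h1
    have hk1 : (k : ℝ) < Real.logb 10 (X ω) := by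
      rw [Real.lt_logb_iff_rpow_lt (by norm_num) hX0]
      exact_mod_cast h1
    have hk2 : Real.logb 10 (X ω) < k + 1 := by
      rw [Real.logb_lt_iff_lt_rpow (by norm_num) hX0]
      exact_mod_cast h2
    have hL1 : a < Real.logb 10 (Real.logb 10 (X ω)) :=
      Real.logb_lt_logb (by norm_num) (by positivity) hk1
    have hL2 : Real.logb 10 (Real.logb 10 (X ω)) < b :=
      Real.logb_lt_logb (by norm_num) (by linarith) hk2
    generalize Real.logb 10 (Real.logb 10 (X ω)) = L at hL1 hL2
    have hfl1 : ⌊a⌋ ≤ ⌊L⌋ := Int.floor_le_floor hL1.le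
    have hfl2 : ⌊L⌋ < ⌊a⌋ + 2 := by
      rw [Int.floor_lt]
      push_cast
      linarith [Int.lt_floor_add_one a]
    rw [Int.fract, hS]
    obtain hn | hn : ⌊L⌋ = ⌊a⌋ ∨ ⌊L⌋ = ⌊a⌋ + 1 := by omega
    · left
      rw [hn]
      constructor <;> linarith
    · right
      rw [hn]
      push_cast
      constructor <;> linarith
  have hone : Measure.map (fun ω => Int.fract (Real.logb 10 (Real.logb 10 (X ω)))) ℙ S = 1 := by
    rw [Measure.map_apply hfm hSm]
    exact (mem_ae_iff_prob_eq_one (hfm hSm)).1 hfS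
  have hlt : volume.restrict (Ico (0 : ℝ) 1) S < 1 :=
    calc volume.restrict (Ico (0 : ℝ) 1) S ≤ volume S := Measure.restrict_apply_le _ _
      _ ≤ ENNReal.ofReal (b - a) + ENNReal.ofReal (b - a) := by
        refine (measure_union_le _ _).trans_eq ?_
        rw [Real.volume_Ioo, Real.volume_Ioo]
        congr 2 <;> ring
      _ = ENNReal.ofReal (2 * (b - a)) := by
        rw [← ENNReal.ofReal_add (by linarith) (by linarith), two_mul]
      _ < 1 := by
        rw [← ENNReal.ofReal_one]
        exact (ENNReal.ofReal_lt_ofReal_iff one_pos).2 hab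
  rw [h] at hone
  exact hlt.ne hone
end
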